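/- For every integer k > 0, the set C^k of k-differentiable words over Σ = {1,2} is a regular language, i.e., it is accepted by a deterministic finite automaton. -/

import Mathlib

/- Common framework: words over the alphabet Σ = {1,2} (represented as natural
numbers), run-length encoding, the derivative D, k-differentiable words C^k,
C∞-words, heights, roots, primitives, minimal/maximal words, simple extensions,
minimal forbidden words, and the left frontier Ψ. -/

namespace CinftyWords

/-- A word is a finite sequence of natural numbers. -/
abbrev Word := List ℕ

/-- `w` is a word over the alphabet Σ = {1,2}. -/
def IsWord (w : Word) : Prop := ∀ x ∈ w, x = 1 ∨ x = 2

/-- Complement of a letter: exchanges 1 and 2. -/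
def bar (x : ℕ) : ℕ := 3 - x

/-- Letterwise complement of a word. -/
def comp (w : Word) : Word := w.map bar

/-- Run-length encoding Δ: the sequence of lengths of maximal runs of equal
consecutive letters. -/
def rle (w : Word) : Word := (w.splitBy (· == ·)).map List.length

/-- Drop the first run if it has length 1. -/
def dropFirstRun1 (g : List (List ℕ)) : List (List ℕ) :=
  match g with
  | [] => []
  | r :: rs => if r.length = 1 then rs else r :: rs

/-- The derivative `D w`: the run-length encoding of the word obtained from `w`
by deleting its first and/or last run when that run has length 1. -/
def D (w : Word) : Word :=
  ((dropFirstRun1 ((dropFirstRun1 (w.splitBy (· == ·))).reverse)).reverse).map List.length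

/-- `w` is differentiable: `w` is a word over Σ and so is its run-length encoding. -/
def Diffble (w : Word) : Prop := IsWord w ∧ IsWord (rle w)

/-- The set C^k of k-differentiable words: `D^[j] w` is differentiable for all `j < k`
(so that `D^[k] w` is defined). -/
def CK (k : ℕ) : Set Word := {w | IsWord w ∧ ∀ j < k, Diffble (D^[j] w)}

/-- The set C∞ of words differentiable arbitrarily many times. -/
def Cinf : Set Word := {w | ∀ k : ℕ, w ∈ CK k}

/-- The height of a C∞-word: the least `k` with `D^[k] w = []`. -/
noncomputable def height (w : Word) : ℕ := sInf {k | D^[k] w = []}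

/-- The root of a C∞-word: `D^[height w - 1] w`. -/
noncomputable def root (w : Word) : Word := D^[height w - 1] w

/-- `v` is a primitive of `w`: `v` is differentiable and `D v = w`. -/
def IsPrimitive (v w : Word) : Prop := Diffble v ∧ D v = w

/-- A nonempty C∞-word is maximal if each `D^[j] w` (for `j ≤ height w - 2`) is a
primitive of `D^[j+1] w` of maximal length (vacuously true when `height w = 1`). -/
def MaximalWord (w : Word) : Prop :=
  w ∈ Cinf ∧ w ≠ [] ∧ ∀ j, j + 2 ≤ height w →
    ∀ v, IsPrimitive v (D^[j + 1] w) → v.length ≤ (D^[j] w).length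

/-- A nonempty C∞-word is minimal if each `D^[j] w` (for `j ≤ height w - 2`) is a
primitive of `D^[j+1] w` of minimal length (vacuously true when `height w = 1`). -/
def MinimalWord (w : Word) : Prop :=
  w ∈ Cinf ∧ w ≠ [] ∧ ∀ j, j + 2 ≤ height w →
    ∀ v, IsPrimitive v (D^[j + 1] w) → (D^[j] w).length ≤ v.length

/-- `w` is right maximal: a suffix of a maximal word. -/
def RightMaximal (w : Word) : Prop := ∃ v, MaximalWord v ∧ w <:+ v

/-- `w` is left maximal: a prefix of a maximal word. -/
def LeftMaximal (w : Word) : Prop := ∃ v, MaximalWord v ∧ w <+: v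

/-- `w` is right minimal: a suffix of a minimal word. -/
def RightMinimal (w : Word) : Prop := ∃ v, MinimalWord v ∧ w <:+ v

/-- `w` is left minimal: a prefix of a minimal word. -/
def LeftMinimal (w : Word) : Prop := ∃ v, MinimalWord v ∧ w <+: v

/-- `w` is right doubly extendable: both `w1` and `w2` are C∞-words. -/
def RightDoublyExt (w : Word) : Prop := w ++ [1] ∈ Cinf ∧ w ++ [2] ∈ Cinf

/-- `w` is left doubly extendable: both `1w` and `2w` are C∞-words. -/
def LeftDoublyExt (w : Word) : Prop := 1 :: w ∈ Cinf ∧ 2 :: w ∈ Cinf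

/-- `w` is fully extendable: `1w1`, `1w2`, `2w1`, `2w2` are all C∞-words. -/
def FullyExt (w : Word) : Prop :=
  ∀ x, (x = 1 ∨ x = 2) → ∀ y, (y = 1 ∨ y = 2) → x :: (w ++ [y]) ∈ Cinf

/-- `w'` is a right simple extension of `w`: `w' = w ++ s` is a C∞-word and at each
step the extension by the complementary letter is not a C∞-word. -/
def RightSimpleExt (w w' : Word) : Prop :=
  w' ∈ Cinf ∧ ∃ s : Word, IsWord s ∧ w' = w ++ s ∧
    ∀ i < s.length, w ++ s.take i ++ [bar (s.getD i 0)] ∉ Cinf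

/-- `w'` is a left simple extension of `w`. -/
def LeftSimpleExt (w w' : Word) : Prop := RightSimpleExt w.reverse w'.reverse

/-- `w'` is a simple extension of `w`: a right simple extension of a left simple
extension of `w`. -/
def SimpleExt (w w' : Word) : Prop := ∃ v, LeftSimpleExt w v ∧ RightSimpleExt v w'

/-- `m` is the maximal extension of `w`: a simple extension of `w` of maximal length. -/
def IsMaximalExtension (w m : Word) : Prop :=
  SimpleExt w m ∧ ∀ v, SimpleExt w v → v.length ≤ m.length

/-- A language is factorial if it is closed under taking factors. -/
def Factorial (F : Set Word) : Prop := ∀ v ∈ F, ∀ u, u <:+: v → u ∈ F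

/-- A language is anti-factorial if no word of it is a proper factor of another
word of it. -/
def AntiFactorial (M : Set Word) : Prop := ∀ u ∈ M, ∀ v ∈ M, u ≠ v → ¬ u <:+: v

/-- The set of minimal forbidden words of a (factorial) language `F`: words not
in `F` whose maximal proper prefix and maximal proper suffix are both in `F`. -/
def MF (F : Set Word) : Set Word := {v | v ∉ F ∧ v.dropLast ∈ F ∧ v.tail ∈ F}

/-- The height of a minimal forbidden word of C∞: `k + 1`, where `k` is the
(unique) integer such that `w` is k-differentiable and `D^[k] w ∈ {111, 222}`. -/
noncomputable def MFheight (w : Word) : ℕ :=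
  sInf {k | w ∈ CK k ∧ (D^[k] w = [1, 1, 1] ∨ D^[k] w = [2, 2, 2])} + 1

/-- The left frontier Ψ of a C∞-word: the word of length `height w` over {0,1,2}
recording the first letter of each derivative, with `2` replaced by `0` when the
first two letters of the previous derivative are distinct. -/
noncomputable def psi (w : Word) : List ℕ :=
  (List.range (height w)).map (fun i =>
    if i = 0 then w.getD 0 0
    else if (D^[i] w).getD 0 0 = 2 ∧ (D^[i - 1] w).getD 0 0 ≠ (D^[i - 1] w).getD 1 0 then 0
    else (D^[i] w).getD 0 0)

end CinftyWords

namespace CinftyWords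

/-- A language is regular as soon as it belongs to a finite family of languages that is closed
under left quotients by single letters. -/
theorem isRegular_of_finite_closed {α : Type*} {L : Language α} {S : Set (Language α)}
    (hS : S.Finite) (hL : L ∈ S) (hstep : ∀ K ∈ S, ∀ x, K.leftQuotient [x] ∈ S) :
    L.IsRegular := by
  refine Language.IsRegular.of_finite_range_leftQuotient (hS.subset ?_)
  rintro _ ⟨u, rfl⟩
  induction u using List.reverseRecOn with
  | nil => exact hL
  | append_singleton u x ih =>
    rw [Language.leftQuotient_append]
    exact hstep _ ih x

theorem language_eq_zero {α : Type*} {L : Language α} (h : ∀ v, v ∉ L) : L = 0 :=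
  Set.eq_empty_iff_forall_notMem.2 h

theorem isWord_cons {x : ℕ} {v : Word} : IsWord (x :: v) ↔ (x = 1 ∨ x = 2) ∧ IsWord v :=
  List.forall_mem_cons

/-- The language of all words over Σ. -/
def words : Language ℕ := {w | IsWord w}

theorem isRegular_words : words.IsRegular := by
  refine isRegular_of_finite_closed (S := {words, 0}) (by simp) (by simp) ?_
  rintro K (rfl | rfl) x
  · by_cases hx : x = 1 ∨ x = 2
    · refine Or.inl (Set.ext fun v => ?_)
      exact isWord_cons.trans (and_iff_right hx)
    · refine Or.inr (language_eq_zero fun v hv => hx (isWord_cons.1 hv).1)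
  · exact Or.inr rfl

theorem rle_replicate_append_cons {n a x : ℕ} (hn : n ≠ 0) (hax : x ≠ a) (v : Word) :
    rle (List.replicate n a ++ x :: v) = n :: rle (x :: v) := by
  have hne : List.replicate n a ≠ [] := by simpa using hn
  have h1 : (List.replicate n a).splitBy (· == ·) = [List.replicate n a] := by
    refine List.splitBy_of_isChain hne ?_
    refine (List.pairwise_replicate.2 (Or.inr ?_)).isChain
    simp
  have h2 : ∀ y ∈ (List.replicate n a).getLast?, (y == x) = false := by
    intro y hy
    have := List.eq_of_mem_replicate (List.mem_of_mem_getLast? hy)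
    simpa [this] using hax.symm
  rw [rle, List.splitBy_append_cons v h2, h1]
  simp [rle]

theorem rle_replicate {n a : ℕ} (hn : n ≠ 0) : rle (List.replicate n a) = [n] := by
  have hne : List.replicate n a ≠ [] := by simpa using hn
  rw [rle, List.splitBy_of_isChain hne]
  · simp
  · refine (List.pairwise_replicate.2 (Or.inr ?_)).isChain
    simp

theorem replicate_append_cons_self (n a : ℕ) (v : Word) :
    List.replicate n a ++ a :: v = List.replicate (n + 1) a ++ v := by
  simp [List.replicate_succ']

theorem exists_le_mem_rle (a : ℕ) (v : Word) {n : ℕ} (hn : n ≠ 0) :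
    ∃ m ∈ rle (List.replicate n a ++ v), n ≤ m := by
  induction v generalizing n with
  | nil => exact ⟨n, by simp [rle_replicate hn], le_rfl⟩
  | cons x v ih =>
    by_cases hx : x = a
    · subst hx
      obtain ⟨m, hm, hle⟩ := ih n.succ_ne_zero
      rw [replicate_append_cons_self]
      exact ⟨m, hm, by omega⟩
    · exact ⟨n, by simp [rle_replicate_append_cons hn hx], le_rfl⟩

/-- The words over Σ which, once prefixed by `n` letters `a`, have their run-length encoding
in `Q` and over Σ. -/
def rlePreimage (Q : Language ℕ) (n a : ℕ) : Language ℕ :=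
  {v | IsWord v ∧ IsWord (rle (List.replicate n a ++ v)) ∧ rle (List.replicate n a ++ v) ∈ Q}

theorem rlePreimage_leftQuotient_self (Q : Language ℕ) (n : ℕ) {a : ℕ} (ha : a = 1 ∨ a = 2) :
    (rlePreimage Q n a).leftQuotient [a] = rlePreimage Q (n + 1) a := by
  ext v
  change IsWord (a :: v) ∧ IsWord (rle (List.replicate n a ++ a :: v)) ∧
    rle (List.replicate n a ++ a :: v) ∈ Q ↔ _
  rw [isWord_cons, replicate_append_cons_self, and_iff_right ha]
  exact Iff.rfl

theorem rlePreimage_eq_zero (Q : Language ℕ) {n : ℕ} (hn : 2 < n) (a : ℕ) :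
    rlePreimage Q n a = 0 := by
  refine language_eq_zero fun v hv => ?_
  obtain ⟨m, hm, hle⟩ := exists_le_mem_rle a v (n := n) (by omega)
  have := hv.2.1 m hm
  omega

theorem rlePreimage_leftQuotient_of_ne (Q : Language ℕ) {n a x : ℕ} (hn : n = 1 ∨ n = 2)
    (hx : x = 1 ∨ x = 2) (hxa : x ≠ a) :
    (rlePreimage Q n a).leftQuotient [x] = rlePreimage (Q.leftQuotient [n]) 1 x := by
  ext v
  change IsWord (x :: v) ∧ IsWord (rle (List.replicate n a ++ x :: v)) ∧
    rle (List.replicate n a ++ x :: v) ∈ Q ↔ _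
  rw [rle_replicate_append_cons (by omega) hxa, isWord_cons, isWord_cons, and_iff_right hx,
    and_iff_right hn]
  exact Iff.rfl

theorem rlePreimage_leftQuotient_of_not_letter (Q : Language ℕ) (n a : ℕ) {x : ℕ}
    (hx : ¬ (x = 1 ∨ x = 2)) : (rlePreimage Q n a).leftQuotient [x] = 0 :=
  language_eq_zero fun _ hv => hx (isWord_cons.1 hv.1).1

theorem isRegular_rlePreimage {L : Language ℕ} (hL : L.IsRegular) :
    (rlePreimage L 0 1).IsRegular := by
  let F : Language ℕ × ℕ × ℕ → Language ℕ := fun p => rlePreimage p.1 p.2.1 p.2.2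
  let T : Set (Language ℕ × ℕ × ℕ) := Set.range L.leftQuotient ×ˢ Set.Iic 2 ×ˢ Set.Iic 2
  have hT : T.Finite :=
    hL.finite_range_leftQuotient.prod ((Set.finite_Iic 2).prod (Set.finite_Iic 2))
  refine isRegular_of_finite_closed (S := insert 0 (F '' T)) ((hT.image F).insert _)
    (Or.inr ⟨(L, 0, 1), ⟨⟨[], rfl⟩, by simp⟩, rfl⟩) ?_
  rintro K (rfl | ⟨⟨_, n, a⟩, ⟨⟨u, rfl⟩, hn, ha⟩, rfl⟩) x
  · exact Or.inl rfl
  simp only [Set.mem_Iic] at hn ha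
  by_cases hx : x = 1 ∨ x = 2
  swap
  · exact Or.inl (rlePreimage_leftQuotient_of_not_letter _ _ _ hx)
  have hx2 : x ≤ 2 := by omega
  by_cases hn0 : n = 0
  · subst hn0
    exact Or.inr ⟨(L.leftQuotient u, 1, x), ⟨⟨u, rfl⟩, by simp, hx2⟩,
      (rlePreimage_leftQuotient_self _ 0 hx).symm⟩
  by_cases hxa : x = a
  · subst hxa
    have h := rlePreimage_leftQuotient_self (L.leftQuotient u) n hx
    by_cases hn2 : n = 2
    · exact Or.inl (h.trans (rlePreimage_eq_zero _ (by omega) _))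
    · exact Or.inr ⟨(L.leftQuotient u, n + 1, x),
        ⟨⟨u, rfl⟩, by simp only [Set.mem_Iic]; omega, hx2⟩, h.symm⟩
  · refine Or.inr ⟨(L.leftQuotient (u ++ [n]), 1, x), ⟨⟨_, rfl⟩, by simp, hx2⟩, ?_⟩
    rw [Language.leftQuotient_append]
    exact (rlePreimage_leftQuotient_of_ne _ (by omega) hx hxa).symm

/-- Remove the first letter of a word if it is `1`. -/
def dropLeadingOne : Word → Word
  | [] => []
  | x :: v => if x = 1 then v else x :: v

theorem isRegular_dropLeadingOne_preimage {L : Language ℕ} (hL : L.IsRegular) :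
    Language.IsRegular ({w | dropLeadingOne w ∈ L} : Set Word) := by
  refine Language.IsRegular.of_finite_range_leftQuotient
    ((hL.finite_range_leftQuotient.insert
      (Language.leftQuotient ({w | dropLeadingOne w ∈ L} : Set Word) [])).subset ?_)
  rintro _ ⟨_ | ⟨x, u⟩, rfl⟩
  · exact Or.inl rfl
  · refine Or.inr ⟨dropLeadingOne (x :: u), ?_⟩
    ext v
    change dropLeadingOne (x :: u) ++ v ∈ L ↔ dropLeadingOne (x :: (u ++ v)) ∈ L
    simp only [dropLeadingOne]
    split_ifs <;> rfl

theorem map_length_dropFirstRun1 (g : List (List ℕ)) :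
    (dropFirstRun1 g).map List.length = dropLeadingOne (g.map List.length) := by
  cases g with
  | nil => rfl
  | cons r rs =>
    simp only [dropFirstRun1, dropLeadingOne, List.map_cons]
    split_ifs <;> rfl

theorem D_eq (w : Word) :
    D w = (dropLeadingOne (dropLeadingOne (rle w)).reverse).reverse := by
  simp only [D, rle, List.map_reverse, map_length_dropFirstRun1]

theorem isRegular_D_preimage {L : Language ℕ} (hL : L.IsRegular) :
    Language.IsRegular ({w | Diffble w ∧ D w ∈ L} : Set Word) := by
  have h := isRegular_rlePreimage (isRegular_dropLeadingOne_preimage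
    (isRegular_dropLeadingOne_preimage hL.reverse).reverse)
  refine (congrArg Language.IsRegular (Set.ext fun w => ?_)).mpr h
  change Diffble w ∧ D w ∈ L ↔ IsWord w ∧ IsWord (rle w) ∧
    (dropLeadingOne (dropLeadingOne (rle w)).reverse).reverse ∈ L
  rw [D_eq, Diffble, and_assoc]

theorem isRegular_forall_diffble_iterate (k : ℕ) :
    Language.IsRegular ({w | ∀ j < k, Diffble (D^[j] w)} : Set Word) := by
  induction k with
  | zero =>
    refine isRegular_of_finite_closed (S := {(⊤ : Language ℕ)})
      (Set.finite_singleton _) (Set.ext fun w => ?_) ?_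
    · exact iff_of_true (fun j hj => absurd hj j.not_lt_zero) trivial
    · rintro _ rfl x
      rfl
  | succ k ih =>
    refine (congrArg Language.IsRegular (Set.ext fun w => ?_)).mpr (isRegular_D_preimage ih)
    change (∀ j < k + 1, Diffble (D^[j] w)) ↔ Diffble w ∧ ∀ j < k, Diffble (D^[j] (D w))
    constructor
    · intro h
      exact ⟨h 0 k.succ_pos, fun j hj => h (j + 1) (Nat.succ_lt_succ hj)⟩
    · rintro ⟨h0, h⟩ (_ | j) hj
      · exact h0
      · exact h j (Nat.lt_of_succ_lt_succ hj)

end CinftyWords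

open CinftyWords in
/-- For every `k > 0`, the set `C^k` of k-differentiable words is a regular language:
it is accepted by a deterministic finite automaton. -/
theorem ck_regular (k : ℕ) (hk : 0 < k) :
    ∃ (Q : Type) (_ : Fintype Q) (dfa : DFA ℕ Q), dfa.accepts = CK k := by
  exact isRegular_words.inf (isRegular_forall_diffble_iterate k)
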